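/- Assume MFCQ holds at every x ∈ ℝ^n, the convexity assumption holds, 0 < α < μ ≤ L_l, and 0 < T ≤ 2/(L_l + μ), where additionally for every x the map y ↦ ∇_x l(y, λ*_{I_x}) is L_l-Lipschitz. Define x_{k+1} := x_k + T v(x_k) from any x_0 ∈ ℝ^n. Then for every k ≥ 0, d(x_{k+1}) ≥ d(x_k) + c₂ T (f*_{I_{x_k}} − d(x_k)), where c₂ := 2α(1 − μT/2)(μ − α)/(L_l − α); moreover 0 < c₂ T < 1. -/

import Mathlib

open scoped RealInnerProductSpace
open Filter

section FirstOrder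

variable {E : Type*} [NormedAddCommGroup E] [InnerProductSpace ℝ E] [CompleteSpace E]

theorem HasGradientAt.hasDerivAt_comp_line {φ : E → ℝ} {p x d : E} {t : ℝ}
    (hφ : HasGradientAt φ p (x + t • d)) :
    HasDerivAt (fun s : ℝ => φ (x + s • d)) ⟪p, d⟫ t := by
  have hline : HasDerivAt (fun s : ℝ => x + s • d) d t := by
    simpa using ((hasDerivAt_id t).smul_const d).const_add x
  exact (hφ.hasFDerivAt.comp_hasDerivAt t hline).congr_deriv (by simp)

theorem ConvexOn.add_inner_gradient_le {φ : E → ℝ} {p x : E} (hc : ConvexOn ℝ Set.univ φ)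
    (hφ : HasGradientAt φ p x) (y : E) : φ x + ⟪p, y - x⟫ ≤ φ y := by
  have hd : HasDerivAt (fun s : ℝ => φ (x + s • (y - x))) ⟪p, y - x⟫ 0 :=
    HasGradientAt.hasDerivAt_comp_line (by simpa using hφ)
  have hconv : ConvexOn ℝ Set.univ (fun s : ℝ => φ (x + s • (y - x))) := by
    have := hc.comp_affineMap (AffineMap.lineMap x y : ℝ →ᵃ[ℝ] E)
    refine this.congr fun s _ => ?_
    simp [AffineMap.lineMap_apply, add_comm]
  have h := hconv.le_slope_of_hasDerivAt (Set.mem_univ 0) (Set.mem_univ 1) one_pos hd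
  simp [slope_def_field] at h
  linarith

theorem ConcaveOn.le_add_inner_gradient {φ : E → ℝ} {p x : E} (hc : ConcaveOn ℝ Set.univ φ)
    (hφ : HasGradientAt φ p x) (y : E) : φ y ≤ φ x + ⟪p, y - x⟫ := by
  have hneg : HasGradientAt (-φ) (-p) x := by
    rw [hasGradientAt_iff_hasFDerivAt] at hφ ⊢
    simpa using hφ.neg
  have h := hc.neg.add_inner_gradient_le hneg y
  simp only [Pi.neg_apply, inner_neg_left] at h
  linarith

theorem StrongConvexOn.add_inner_gradient_add_le {φ : E → ℝ} {p x : E} {μ : ℝ}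
    (hc : StrongConvexOn Set.univ μ φ) (hφ : HasGradientAt φ p x) (y : E) :
    φ x + ⟪p, y - x⟫ + μ / 2 * ‖y - x‖ ^ 2 ≤ φ y := by
  have hgrad : HasGradientAt (fun z => φ z - μ / 2 * ‖z‖ ^ 2) (p - μ • x) x := by
    rw [hasGradientAt_iff_hasFDerivAt] at hφ ⊢
    refine (hφ.sub ((hasStrictFDerivAt_norm_sq x).hasFDerivAt.const_mul (μ / 2))).congr_fderiv ?_
    ext z
    simp
    ring
  have h := (strongConvexOn_iff_convex.1 hc).add_inner_gradient_le hgrad y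
  have hy : ‖y‖ ^ 2 = ‖x‖ ^ 2 + 2 * ⟪x, y - x⟫ + ‖y - x‖ ^ 2 := by
    rw [← norm_add_sq_real, add_sub_cancel]
  rw [hy, inner_sub_left, real_inner_smul_left] at h
  linarith

/-- The quadratic upper bound for a function with Lipschitz gradient. -/
theorem le_add_inner_gradient_add_of_lipschitz {φ : E → ℝ} {G : E → E} {L : ℝ}
    (hφ : ∀ x, HasGradientAt φ (G x) x) (hG : ∀ x y, ‖G x - G y‖ ≤ L * ‖x - y‖) (x y : E) :
    φ y ≤ φ x + ⟪G x, y - x⟫ + L / 2 * ‖y - x‖ ^ 2 := by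
  set d := y - x with hd
  let k : ℝ → ℝ := fun t => φ (x + t • d) - t * ⟪G x, d⟫ - L / 2 * ‖d‖ ^ 2 * t ^ 2
  have hk : ∀ t, HasDerivAt k (⟪G (x + t • d), d⟫ - ⟪G x, d⟫ - L * ‖d‖ ^ 2 * t) t := by
    intro t
    have h1 := (hφ (x + t • d)).hasDerivAt_comp_line
    have h2 : HasDerivAt (fun s : ℝ => s * ⟪G x, d⟫) ⟪G x, d⟫ t := by
      simpa using (hasDerivAt_id t).mul_const ⟪G x, d⟫
    have h3 : HasDerivAt (fun s : ℝ => L / 2 * ‖d‖ ^ 2 * s ^ 2) (L * ‖d‖ ^ 2 * t) t := by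
      refine ((hasDerivAt_pow 2 t).const_mul (L / 2 * ‖d‖ ^ 2)).congr_deriv ?_
      simp
      ring
    exact (h1.sub h2).sub h3
  have hanti : AntitoneOn k (Set.Icc 0 1) := by
    refine antitoneOn_of_hasDerivWithinAt_nonpos (convex_Icc 0 1)
      (fun t _ => (hk t).continuousAt.continuousWithinAt)
      (fun t _ => (hk t).hasDerivWithinAt) fun t ht => ?_
    have ht0 : 0 ≤ t := (interior_subset ht).1
    have h1 : ⟪G (x + t • d) - G x, d⟫ ≤ ‖G (x + t • d) - G x‖ * ‖d‖ := real_inner_le_norm _ _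
    have h2 := hG (x + t • d) x
    rw [add_sub_cancel_left, norm_smul, Real.norm_of_nonneg ht0] at h2
    rw [inner_sub_left] at h1
    nlinarith [mul_le_mul_of_nonneg_right h2 (norm_nonneg d)]
  have h01 := hanti (Set.left_mem_Icc.2 zero_le_one) (Set.right_mem_Icc.2 zero_le_one) zero_le_one
  simp only [k, hd] at h01
  simp at h01
  linarith

theorem HasDerivAt.eventually_lt_nhdsGT {k : ℝ → ℝ} {c a : ℝ} (hk : HasDerivAt k c a)
    (hc : 0 < c) : ∀ᶠ t in nhdsWithin a (Set.Ioi a), k a < k t := by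
  have h := (hasDerivAt_iff_tendsto_slope.1 hk).mono_left
    (nhdsWithin_mono a fun t (ht : a < t) => ht.ne')
  filter_upwards [h.eventually (lt_mem_nhds hc), self_mem_nhdsWithin] with t ht hat
  rw [slope_def_field] at ht
  have : 0 < t - a := sub_pos.2 hat
  have := (div_pos_iff_of_pos_right this).1 ht
  linarith

end FirstOrder

section GradientStep

variable {E : Type*} [NormedAddCommGroup E] [InnerProductSpace ℝ E]

/-- Cocoercivity of the gradient of `φ - μ/2 ‖·‖²` when `φ` is `μ`-strongly convex and
`L`-smooth. -/
theorem norm_sq_le_mul_inner_of_strong_of_smooth {φ : E → ℝ} {G : E → E} {μ L : ℝ} (hμL : μ ≤ L)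
    (hlow : ∀ x y, φ x + ⟪G x, y - x⟫ + μ / 2 * ‖y - x‖ ^ 2 ≤ φ y)
    (hup : ∀ x y, φ y ≤ φ x + ⟪G x, y - x⟫ + L / 2 * ‖y - x‖ ^ 2) (a b : E) :
    ‖G b - G a - μ • (b - a)‖ ^ 2 ≤ (L - μ) * ⟪G b - G a - μ • (b - a), b - a⟫ := by
  obtain ⟨e, rfl⟩ : ∃ e, b = a + e := ⟨b - a, by simp⟩
  rw [add_sub_cancel_left]
  set r := G (a + e) - G a - μ • e with hr
  have hGb : G (a + e) = G a + r + μ • e := by rw [hr]; abel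
  have key : ∀ t : ℝ, (2 * t - (L - μ) * t ^ 2) * ‖r‖ ^ 2 ≤ ⟪r, e⟫ := by
    intro t
    have h1 := hlow a (a + e - t • r)
    have h2 := hup (a + e) (a + e - t • r)
    have h3 := hlow (a + e) (a + t • r)
    have h4 := hup a (a + t • r)
    rw [show a + e - t • r - a = e - t • r by abel] at h1
    rw [show a + e - t • r - (a + e) = -(t • r) by abel] at h2
    rw [show a + t • r - (a + e) = -(e - t • r) by abel] at h3
    rw [show a + t • r - a = t • r by abel] at h4
    have hn : ‖e - t • r‖ ^ 2 = ‖e‖ ^ 2 - 2 * t * ⟪r, e⟫ + t ^ 2 * ‖r‖ ^ 2 := by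
      rw [norm_sub_sq_real, norm_smul, real_inner_smul_right, real_inner_comm, mul_pow,
        Real.norm_eq_abs, sq_abs]
      ring
    have hn' : ‖t • r‖ ^ 2 = t ^ 2 * ‖r‖ ^ 2 := by
      rw [norm_smul, mul_pow, Real.norm_eq_abs, sq_abs]
    rw [norm_neg, hn'] at h2
    rw [norm_neg, hn] at h3
    rw [hn] at h1
    rw [hn'] at h4
    simp only [hGb, inner_add_left, inner_sub_right, inner_neg_right, real_inner_smul_left,
      real_inner_smul_right, real_inner_self_eq_norm_sq, real_inner_comm r e] at h1 h2 h3 h4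
    linarith
  rcases hμL.eq_or_lt with rfl | hlt
  · simp only [sub_self, zero_mul, sub_zero] at key ⊢
    by_contra! hpos
    have := key ((⟪r, e⟫ + 1) / (2 * ‖r‖ ^ 2))
    rw [mul_right_comm, mul_div_cancel₀ _ (by positivity)] at this
    linarith
  · have hM : 0 < L - μ := sub_pos.2 hlt
    have := key (1 / (L - μ))
    rw [show 2 * (1 / (L - μ)) - (L - μ) * (1 / (L - μ)) ^ 2 = 1 / (L - μ) by
      field_simp; ring, one_div, inv_mul_le_iff₀ hM] at this
    exact this

/-- Increase of `φ - 1/(2α) ‖∇φ‖²` along a gradient step. -/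
theorem gradient_step_le {φ : E → ℝ} {G : E → E} {μ L α T : ℝ} (hα : 0 < α) (hμL : μ ≤ L)
    (hT0 : 0 < T) (hT : T * (L + μ) ≤ 2)
    (hlow : ∀ x y, φ x + ⟪G x, y - x⟫ + μ / 2 * ‖y - x‖ ^ 2 ≤ φ y)
    (hup : ∀ x y, φ y ≤ φ x + ⟪G x, y - x⟫ + L / 2 * ‖y - x‖ ^ 2) (x : E) :
    φ x - 1 / (2 * α) * ‖G x‖ ^ 2 + T * (1 - μ * T / 2) * (μ - α) / α * ‖G x‖ ^ 2 ≤
      φ (x - T • G x) - 1 / (2 * α) * ‖G (x - T • G x)‖ ^ 2 := by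
  have h1 := hlow x (x - T • G x)
  have h2 := norm_sq_le_mul_inner_of_strong_of_smooth hμL hlow hup x (x - T • G x)
  rw [show x - T • G x - x = -(T • G x) by abel] at h1 h2
  set p := G x
  set r := G (x - T • p) - p - μ • -(T • p) with hr
  have hq : G (x - T • p) = (1 - μ * T) • p + r := by rw [hr]; module
  have hn : ‖(1 - μ * T) • p + r‖ ^ 2 =
      (1 - μ * T) ^ 2 * ‖p‖ ^ 2 + 2 * (1 - μ * T) * ⟪r, p⟫ + ‖r‖ ^ 2 := by
    rw [norm_add_sq_real, norm_smul, mul_pow, Real.norm_eq_abs, sq_abs, real_inner_smul_left,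
      real_inner_comm]
    ring
  rw [norm_neg, norm_smul, mul_pow, Real.norm_eq_abs, sq_abs, inner_neg_right,
    real_inner_smul_right, real_inner_self_eq_norm_sq] at h1
  rw [inner_neg_right, real_inner_smul_right] at h2
  rw [hq, hn]
  have hc : 0 ≤ -⟪r, p⟫ := by
    rcases hμL.eq_or_lt with rfl | hlt
    · have hr0 : ‖r‖ ^ 2 ≤ 0 := by simpa using h2
      have : r = 0 := by simpa using le_antisymm hr0 (sq_nonneg _)
      simp [this]
    · by_contra! hneg
      have : 0 < (L - μ) * T := mul_pos (sub_pos.2 hlt) hT0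
      nlinarith [sq_nonneg ‖r‖]
  have hr2 : ‖r‖ ^ 2 ≤ 2 * (1 - μ * T) * -⟪r, p⟫ := by
    nlinarith [mul_nonneg (sub_nonneg.2 hT) hc]
  have h3 : 0 ≤ 1 / (2 * α) * (2 * (1 - μ * T) * -⟪r, p⟫ - ‖r‖ ^ 2) :=
    mul_nonneg (by positivity) (by linarith)
  have h4 : T * (1 - μ * T / 2) * (μ - α) / α * ‖p‖ ^ 2 =
      -(T * ‖p‖ ^ 2) + μ / 2 * (T ^ 2 * ‖p‖ ^ 2) +
        1 / (2 * α) * (‖p‖ ^ 2 - (1 - μ * T) ^ 2 * ‖p‖ ^ 2) := by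
    field_simp
    ring
  rw [h4]
  linarith

end GradientStep

section Multipliers

variable {E : Type*} [NormedAddCommGroup E] [InnerProductSpace ℝ E] [FiniteDimensional ℝ E]

/-- A Karush–Kuhn–Tucker alternative under the Mangasarian–Fromovitz condition. -/
theorem exists_multipliers_of_mfcq {ι κ : Type*} [Fintype ι] [Fintype κ] (p : E) (a : ι → E)
    (b : κ → E) (A : ι → Prop)
    (hw : ∃ w, (∀ j, ⟪b j, w⟫ = 0) ∧ ∀ i, A i → 0 < ⟪a i, w⟫)
    (hp : ∀ u, (∀ j, ⟪b j, u⟫ = 0) → (∀ i, A i → 0 < ⟪a i, u⟫) → 0 ≤ ⟪p, u⟫) :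
    ∃ (β : κ → ℝ) (γ : ι → ℝ), (∀ i, 0 ≤ γ i) ∧ (∀ i, ¬ A i → γ i = 0) ∧
      p = (∑ j, β j • b j) + ∑ i, γ i • a i := by
  classical
  let Φ : (Option ι → ℝ) →ₗ[ℝ] E := Fintype.linearCombination ℝ (fun o => o.elim p (fun i => -a i))
  have hΦ : ∀ c, Φ c = c none • p - ∑ i, c (some i) • a i := by
    intro c
    simp [Φ, Fintype.linearCombination_apply, Fintype.sum_option, sub_eq_add_neg]
  let K : Set (Option ι → ℝ) := stdSimplex ℝ (Option ι) ∩ {c | ∀ i, ¬ A i → c (some i) = 0}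
  let W : Submodule ℝ E := Submodule.span ℝ (Set.range b)
  have hKc : IsCompact K := by
    refine (isCompact_stdSimplex ℝ (Option ι)).inter_right ?_
    simp only [Set.ofPred_forall]
    exact isClosed_iInter fun i => isClosed_iInter fun _ =>
      isClosed_eq (continuous_apply _) continuous_const
  have hKconv : Convex ℝ K := by
    refine (convex_stdSimplex ℝ (Option ι)).inter ?_
    intro c hc c' hc' s t _ _ _ i hi
    simp [hc i hi, hc' i hi]
  have hmeet : ¬ Disjoint (Φ '' K) (W : Set E) := by
    intro hdisj
    obtain ⟨ℓ, s, s', hs, hss, hs'⟩ := geometric_hahn_banach_compact_closed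
      (hKconv.linear_image Φ) (hKc.image Φ.continuous_of_finiteDimensional)
      W.convex W.closed_of_finiteDimensional hdisj
    have hs_neg : s' < 0 := by simpa using hs' 0 W.zero_mem
    let u := (InnerProductSpace.toDual ℝ E).symm ℓ
    have hu : ∀ z, ⟪z, u⟫ = ℓ z := fun z => by
      rw [real_inner_comm]; exact InnerProductSpace.toDual_symm_apply
    have hpu : ⟪p, u⟫ < 0 := by
      have hmem : Pi.single none 1 ∈ K :=
        ⟨single_mem_stdSimplex ℝ none, fun i _ => by simp⟩
      have := hs _ ⟨_, hmem, rfl⟩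
      rw [hΦ] at this
      simp at this
      rw [hu]; linarith
    refine hpu.not_ge (hp u ?_ ?_)
    · intro j
      rw [hu]
      by_contra hne
      have hm : ((s' - 1) / ℓ (b j)) • b j ∈ W :=
        W.smul_mem _ (Submodule.subset_span ⟨j, rfl⟩)
      have := hs' _ hm
      rw [map_smul, smul_eq_mul, div_mul_cancel₀ _ hne] at this
      linarith
    · intro i hi
      have hmem : Pi.single (some i) 1 ∈ K := by
        refine ⟨single_mem_stdSimplex ℝ (some i), fun i' hi' => ?_⟩
        rw [Pi.single_eq_of_ne]
        rintro h
        exact hi' (Option.some_injective _ h ▸ hi)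
      have := hs _ ⟨_, hmem, rfl⟩
      rw [hΦ] at this
      simp [Pi.single_apply] at this
      rw [hu]; linarith
  obtain ⟨_, ⟨c, ⟨⟨hc0, hc1⟩, hcA⟩, rfl⟩, hcW⟩ := Set.not_disjoint_iff.1 hmeet
  obtain ⟨β, hβ⟩ := (Submodule.mem_span_range_iff_exists_fun ℝ).1 hcW
  rw [hΦ] at hβ
  have hne : c none ≠ 0 := by
    intro h0
    obtain ⟨w, hwb, hwa⟩ := hw
    have hin : ∑ i, c (some i) * ⟪a i, w⟫ = 0 := by
      have := congrArg (fun z => ⟪z, w⟫) hβ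
      simp only [h0, zero_smul, zero_sub, inner_neg_left, sum_inner, real_inner_smul_left, hwb,
        mul_zero, Finset.sum_const_zero] at this
      linarith
    have hnn : ∀ i ∈ Finset.univ, 0 ≤ c (some i) * ⟪a i, w⟫ := by
      intro i _
      by_cases hi : A i
      · exact mul_nonneg (hc0 _) (hwa i hi).le
      · simp [hcA i hi]
    have hz : ∀ i, c (some i) = 0 := by
      intro i
      by_cases hi : A i
      · exact (mul_eq_zero.1 ((Finset.sum_eq_zero_iff_of_nonneg hnn).1 hin i
          (Finset.mem_univ i))).resolve_right (hwa i hi).ne'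
      · exact hcA i hi
    rw [Fintype.sum_option] at hc1
    simp [h0, hz] at hc1
  refine ⟨fun j => (c none)⁻¹ * β j, fun i => (c none)⁻¹ * c (some i),
    fun i => mul_nonneg (inv_nonneg.2 (hc0 _)) (hc0 _), fun i hi => by simp [hcA i hi], ?_⟩
  simp only [mul_smul, ← Finset.smul_sum]
  rw [← smul_add, hβ, sub_add_cancel, smul_smul, inv_mul_cancel₀ hne, one_smul]

end Multipliers

section Lagrangian

variable {E : Type*} [NormedAddCommGroup E] [InnerProductSpace ℝ E] {ι κ : Type*} [Fintype ι]
  [Fintype κ]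

/-- The Lagrangian `f - ∑ βⱼ hⱼ - ∑ γᵢ gᵢ`. -/
def lagrangian (f : E → ℝ) (h : κ → E → ℝ) (g : ι → E → ℝ) (β : κ → ℝ) (γ : ι → ℝ) (y : E) : ℝ :=
  f y - ((∑ j, β j * h j y) + ∑ i, γ i * g i y)

/-- The gradient of the Lagrangian, in terms of the gradients of its constituents. -/
def lagrangianGrad (gf : E → E) (gh : κ → E → E) (gg : ι → E → E) (β : κ → ℝ) (γ : ι → ℝ)
    (y : E) : E :=
  gf y - ((∑ j, β j • gh j y) + ∑ i, γ i • gg i y)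

variable {f : E → ℝ} {h : κ → E → ℝ} {g : ι → E → ℝ} {gf : E → E} {gh : κ → E → E}
  {gg : ι → E → E}

theorem hasGradientAt_lagrangian [CompleteSpace E] (hf : ∀ y, HasGradientAt f (gf y) y)
    (hh : ∀ j y, HasGradientAt (h j) (gh j y) y) (hg : ∀ i y, HasGradientAt (g i) (gg i y) y)
    (β : κ → ℝ) (γ : ι → ℝ) (y : E) :
    HasGradientAt (lagrangian f h g β γ) (lagrangianGrad gf gh gg β γ y) y := by
  simp only [hasGradientAt_iff_hasFDerivAt] at *
  have h1 := HasFDerivAt.fun_sum (u := Finset.univ) fun j _ => (hh j y).const_mul (β j)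
  have h2 := HasFDerivAt.fun_sum (u := Finset.univ) fun i _ => (hg i y).const_mul (γ i)
  refine ((hf y).sub (h1.add h2)).congr_fderiv ?_
  simp [lagrangianGrad]

theorem lagrangian_strong {μ : ℝ} {β : κ → ℝ} {γ : ι → ℝ}
    (hf : ∀ x y, f x + ⟪gf x, y - x⟫ + μ / 2 * ‖y - x‖ ^ 2 ≤ f y)
    (hh : ∀ j x y, h j y = h j x + ⟪gh j x, y - x⟫)
    (hg : ∀ i x y, g i y ≤ g i x + ⟪gg i x, y - x⟫) (hγ : ∀ i, 0 ≤ γ i) (x y : E) :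
    lagrangian f h g β γ x + ⟪lagrangianGrad gf gh gg β γ x, y - x⟫ + μ / 2 * ‖y - x‖ ^ 2 ≤
      lagrangian f h g β γ y := by
  have h1 : ∑ j, β j * h j y = ∑ j, β j * h j x + ∑ j, β j * ⟪gh j x, y - x⟫ := by
    rw [← Finset.sum_add_distrib]
    exact Finset.sum_congr rfl fun j _ => by rw [hh j x y, mul_add]
  have h2 : ∑ i, γ i * g i y ≤ ∑ i, γ i * g i x + ∑ i, γ i * ⟪gg i x, y - x⟫ := by
    rw [← Finset.sum_add_distrib]
    refine Finset.sum_le_sum fun i _ => ?_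
    rw [← mul_add]
    exact mul_le_mul_of_nonneg_left (hg i x y) (hγ i)
  have h3 := hf x y
  simp only [lagrangian, lagrangianGrad, inner_sub_left, inner_add_left, sum_inner,
    real_inner_smul_left]
  linarith

theorem lagrangian_add_inner {α : ℝ} {x v : E} (β : κ → ℝ) (γ : ι → ℝ)
    (hv : ∀ j, ⟪gh j x, v⟫ + α * h j x = 0) :
    α * lagrangian f h g β γ x + ⟪lagrangianGrad gf gh gg β γ x, v⟫ =
      α * f x + ⟪gf x, v⟫ - ∑ i, γ i * (⟪gg i x, v⟫ + α * g i x) := by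
  have h1 : α * ∑ j, β j * h j x = -∑ j, β j * ⟪gh j x, v⟫ := by
    rw [Finset.mul_sum, ← Finset.sum_neg_distrib]
    exact Finset.sum_congr rfl fun j _ => by linear_combination β j * hv j
  have h2 : α * ∑ i, γ i * g i x = ∑ i, γ i * (α * g i x) := by
    rw [Finset.mul_sum]
    exact Finset.sum_congr rfl fun i _ => by ring
  simp only [lagrangian, lagrangianGrad, inner_sub_left, inner_add_left, sum_inner,
    real_inner_smul_left, mul_add, mul_sub, Finset.sum_add_distrib, h1, ← h2]
  ring

/-- First-order optimality of a maximizer of the regularized dual in a positive coordinate. -/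
theorem inner_add_le_zero_of_dual_max [DecidableEq ι] {α : ℝ} (hα : 0 < α) {x : E} {β : κ → ℝ}
    {γ : ι → ℝ} {i : ι} (hγi : 0 < γ i)
    (hmax : ∀ ε, 0 < ε → ε ≤ γ i →
      lagrangian f h g β (γ - Pi.single i ε) x -
          1 / (2 * α) * ‖lagrangianGrad gf gh gg β (γ - Pi.single i ε) x‖ ^ 2 ≤
        lagrangian f h g β γ x - 1 / (2 * α) * ‖lagrangianGrad gf gh gg β γ x‖ ^ 2) :
    ⟪gg i x, -lagrangianGrad gf gh gg β γ x⟫ + α * g i x ≤ 0 := by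
  set q := lagrangianGrad gf gh gg β γ x
  set N := ‖gg i x‖ ^ 2
  have hN : 0 ≤ N := sq_nonneg _
  have hbound : ∀ ε, 0 < ε → ε ≤ γ i → ⟪gg i x, -q⟫ + α * g i x ≤ ε / 2 * N := by
    intro ε hε hεi
    have h1 : lagrangian f h g β (γ - Pi.single i ε) x = lagrangian f h g β γ x + ε * g i x := by
      simp [lagrangian, sub_mul, Finset.sum_sub_distrib, Pi.single_apply]
      ring
    have h2 : lagrangianGrad gf gh gg β (γ - Pi.single i ε) x = q + ε • gg i x := by
      simp [q, lagrangianGrad, sub_smul, Finset.sum_sub_distrib, Pi.single_apply]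
      abel
    have h3 := hmax ε hε hεi
    rw [h1, h2, norm_add_sq_real, norm_smul, mul_pow, Real.norm_eq_abs, sq_abs,
      real_inner_smul_right] at h3
    have h4 : ε * g i x ≤ 1 / (2 * α) * (2 * (ε * ⟪q, gg i x⟫) + ε ^ 2 * N) := by linarith
    rw [one_div, inv_mul_eq_div, le_div_iff₀ (by positivity)] at h4
    rw [inner_neg_right, real_inner_comm]
    refine le_of_mul_le_mul_left ?_ hε
    nlinarith
  by_contra! hpos
  set s := ⟪gg i x, -q⟫ + α * g i x
  have hε : 0 < min (γ i) (s / (N + 1)) := lt_min hγi (by positivity)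
  have h1 := hbound _ hε (min_le_left _ _)
  have h2 : min (γ i) (s / (N + 1)) * (N + 1) ≤ s :=
    (le_div_iff₀ (by positivity)).1 (min_le_right _ _)
  nlinarith

end Lagrangian

/-- under MFCQ everywhere, the convexity assumption, `0 < α < μ ≤ L_l`, and
`0 < T ≤ 2/(L_l + μ)`, where additionally for every `x` the map `y ↦ ∇_x l(y, λ*_{I_x})` is
`L_l`-Lipschitz, the iterates `x_{k+1} = x_k + T v(x_k)` satisfy
`d(x_{k+1}) ≥ d(x_k) + c₂ T (f*_{I_{x_k}} − d(x_k))` with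
`c₂ = 2α(1 − μT/2)(μ − α)/(L_l − α)` and `0 < c₂ T < 1`. -/
theorem stmt19
    {E : Type*} [NormedAddCommGroup E] [InnerProductSpace ℝ E] [FiniteDimensional ℝ E]
    {ng nh : ℕ} (hng : 0 < ng) (hnh : 0 < nh)
    (f : E → ℝ) (g : Fin ng → E → ℝ) (h : Fin nh → E → ℝ)
    (gf : E → E) (gg : Fin ng → E → E) (gh : Fin nh → E → E)
    (hf : ∀ y, HasGradientAt f (gf y) y)
    (hg : ∀ i y, HasGradientAt (g i) (gg i y) y)
    (hh : ∀ j y, HasGradientAt (h j) (gh j y) y)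
    (hgfc : Continuous gf) (hggc : ∀ i, Continuous (gg i)) (hghc : ∀ j, Continuous (gh j))
    -- Lipschitz gradients
    (Lf Lg Lh : ℝ)
    (hgfL : ∀ y z, ‖gf y - gf z‖ ≤ Lf * ‖y - z‖)
    (hggL : ∀ i y z, ‖gg i y - gg i z‖ ≤ Lg * ‖y - z‖)
    (hghL : ∀ j y z, ‖gh j y - gh j z‖ ≤ Lh * ‖y - z‖)
    -- MFCQ at every point
    (mfcq : ∀ x : E, LinearIndependent ℝ (fun j : Fin nh => gh j x) ∧
      ∃ w : E, (∀ j : Fin nh, ⟪gh j x, w⟫ = 0) ∧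
        ∀ i : Fin ng, g i x ≤ 0 → 0 < ⟪gg i x, w⟫)
    -- convexity assumption
    (hhaff : ∀ j, ConvexOn ℝ Set.univ (h j) ∧ ConcaveOn ℝ Set.univ (h j))
    (hgconc : ∀ i, ConcaveOn ℝ Set.univ (g i))
    {μ : ℝ} (hμ : 0 < μ) (hfsc : StrongConvexOn Set.univ μ f)
    (hcoer : Tendsto f (cocompact E) atTop)
    (hCne : {y : E | (∀ i, 0 ≤ g i y) ∧ ∀ j, h j y = 0}.Nonempty)
    (hCbd : Bornology.IsBounded {y : E | (∀ i, 0 ≤ g i y) ∧ ∀ j, h j y = 0})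
    (xstar : E) (hxsC : (∀ i, 0 ≤ g i xstar) ∧ ∀ j, h j xstar = 0)
    (hxsmin : ∀ y : E, ((∀ i, 0 ≤ g i y) ∧ ∀ j, h j y = 0) → f xstar ≤ f y)
    -- parameter range
    {α : ℝ} (hα0 : 0 < α) (hαμ : α < μ)
    -- the maximizer `λ(·) = (lamh ·, lamg ·) ∈ D_x` of the dual, and the dual function `d`
    (lamh : E → Fin nh → ℝ) (lamg : E → Fin ng → ℝ)
    (hlam_nn : ∀ y i, 0 ≤ lamg y i)
    (hlam_supp : ∀ y i, 0 < g i y → lamg y i = 0)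
    (dval : E → ℝ)
    (hd_eq : ∀ y : E, dval y =
      (f y - ((∑ j : Fin nh, lamh y j * h j y) + ∑ i : Fin ng, lamg y i * g i y)) -
        1/(2*α) * ‖gf y - ((∑ j : Fin nh, lamh y j • gh j y) +
          ∑ i : Fin ng, lamg y i • gg i y)‖^2)
    (hd_max : ∀ (y : E) (lh : Fin nh → ℝ) (lg : Fin ng → ℝ),
      (∀ i, 0 ≤ lg i) → (∀ i, 0 < g i y → lg i = 0) →
      (f y - ((∑ j : Fin nh, lh j * h j y) + ∑ i : Fin ng, lg i * g i y)) -
        1/(2*α) * ‖gf y - ((∑ j : Fin nh, lh j • gh j y) +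
          ∑ i : Fin ng, lg i • gg i y)‖^2 ≤ dval y)
    -- the velocity field `v(·)` and its relation to `λ(·)`
    (vfun : E → E)
    (hv_mem : ∀ y : E, (∀ j : Fin nh, ⟪gh j y, vfun y⟫ + α * h j y = 0) ∧
      ∀ i : Fin ng, g i y ≤ 0 → 0 ≤ ⟪gg i y, vfun y⟫ + α * g i y)
    (hv_min : ∀ y u : E, (∀ j : Fin nh, ⟪gh j y, u⟫ + α * h j y = 0) →
      (∀ i : Fin ng, g i y ≤ 0 → 0 ≤ ⟪gg i y, u⟫ + α * g i y) →
      1/2 * ‖vfun y + gf y‖^2 ≤ 1/2 * ‖u + gf y‖^2)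
    (hv_lam : ∀ y : E, vfun y =
      -(gf y - ((∑ j : Fin nh, lamh y j • gh j y) + ∑ i : Fin ng, lamg y i • gg i y)))
    -- the smoothness constant `L_l` of the Lagrangian with frozen multiplier `λ(x)`
    {Ll : ℝ} (hμLl : μ ≤ Ll)
    (hLl : ∀ y z z' : E,
      ‖(gf z - ((∑ j : Fin nh, lamh y j • gh j z) + ∑ i : Fin ng, lamg y i • gg i z)) -
        (gf z' - ((∑ j : Fin nh, lamh y j • gh j z') +
          ∑ i : Fin ng, lamg y i • gg i z'))‖ ≤ Ll * ‖z - z'‖)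
    -- step size
    {T : ℝ} (hT0 : 0 < T) (hT : T ≤ 2 / (Ll + μ))
    -- the iterates
    (xseq : ℕ → E)
    (hxs : ∀ k : ℕ, xseq (k + 1) = xseq k + T • vfun (xseq k))
    -- for every `x`, the map `y ↦ ∇_x l(y, λ*_{I_x})` is `L_l`-Lipschitz, where `λ*_{I_x}`
    -- is any KKT multiplier of the restricted problem with index set `I_x`
    (hLlIx : ∀ (x z : E) (lh : Fin nh → ℝ) (lg : Fin ng → ℝ),
      (∀ j : Fin nh, h j z = 0) → (∀ i : Fin ng, g i x ≤ 0 → 0 ≤ g i z) →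
      (∀ z' : E, ((∀ j : Fin nh, h j z' = 0) ∧ ∀ i : Fin ng, g i x ≤ 0 → 0 ≤ g i z') →
        f z ≤ f z') →
      (∀ i, 0 ≤ lg i) → (∀ i : Fin ng, 0 < g i x → lg i = 0) → (∀ i, lg i * g i z = 0) →
      (gf z = (∑ j : Fin nh, lh j • gh j z) + ∑ i : Fin ng, lg i • gg i z) →
      ∀ y y' : E,
        ‖(gf y - ((∑ j : Fin nh, lh j • gh j y) + ∑ i : Fin ng, lg i • gg i y)) -
          (gf y' - ((∑ j : Fin nh, lh j • gh j y') + ∑ i : Fin ng, lg i • gg i y'))‖ ≤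
          Ll * ‖y - y'‖) :
    (0 < 2*α*(1 - μ*T/2)*(μ - α)/(Ll - α) * T ∧
      2*α*(1 - μ*T/2)*(μ - α)/(Ll - α) * T < 1) ∧
    ∀ (k : ℕ) (zI : E),
      -- `zI` is a minimizer of the restricted problem with index set `I_{x_k}`,
      -- so that `f zI = f*_{I_{x_k}}`
      ((∀ j : Fin nh, h j zI = 0) ∧ ∀ i : Fin ng, g i (xseq k) ≤ 0 → 0 ≤ g i zI) →
      (∀ z : E, ((∀ j : Fin nh, h j z = 0) ∧ ∀ i : Fin ng, g i (xseq k) ≤ 0 → 0 ≤ g i z) →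
        f zI ≤ f z) →
      dval (xseq k) + (2*α*(1 - μ*T/2)*(μ - α)/(Ll - α)) * T * (f zI - dval (xseq k)) ≤
        dval (xseq (k + 1)) := by
  have hL : 0 < Ll - α := by linarith
  have hTL : T * (Ll + μ) ≤ 2 := (le_div_iff₀ (by linarith)).1 hT
  have hμT : μ * T ≤ 1 := by nlinarith
  have hc0 : 0 < 1 - μ * T / 2 := by linarith
  refine ⟨⟨by have := sub_pos.2 hαμ; positivity, ?_⟩, ?_⟩
  · have h1 : 2 * α * (1 - μ * T / 2) * (μ - α) / (Ll - α) * T =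
        2 * (α * T) * (1 - μ * T / 2) * ((μ - α) / (Ll - α)) := by ring
    have h2 : (μ - α) / (Ll - α) ≤ 1 := (div_le_one hL).2 (by linarith)
    have h3 : 0 ≤ 2 * (α * T) * (1 - μ * T / 2) := by positivity
    have h4 : α * T < μ * T := mul_lt_mul_of_pos_right hαμ hT0
    rw [h1]
    refine (mul_le_of_le_one_right h3 h2).trans_lt ?_
    nlinarith [sq_nonneg (μ * T - 1)]
  intro k zI hzI hzImin
  rw [hxs k]
  set x := xseq k
  set v := vfun x
  have hfl : ∀ y z, f y + ⟪gf y, z - y⟫ + μ / 2 * ‖z - y‖ ^ 2 ≤ f z :=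
    fun y z => hfsc.add_inner_gradient_add_le (hf y) z
  have hhl : ∀ j y z, h j z = h j y + ⟪gh j y, z - y⟫ := fun j y z =>
    le_antisymm ((hhaff j).2.le_add_inner_gradient (hh j y) z)
      ((hhaff j).1.add_inner_gradient_le (hh j y) z)
  have hgl : ∀ i y z, g i z ≤ g i y + ⟪gg i y, z - y⟫ := fun i y z =>
    (hgconc i).le_add_inner_gradient (hg i y) z
  have hvlam : v = -lagrangianGrad gf gh gg (lamh x) (lamg x) x := hv_lam x
  have hcompl : ∀ i, lamg x i * (⟪gg i x, v⟫ + α * g i x) = 0 := by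
    intro i
    rcases (hlam_nn x i).eq_or_lt with h0 | hpos
    · rw [← h0, zero_mul]
    have hgi : g i x ≤ 0 := by
      by_contra! hgi
      exact hpos.ne' (hlam_supp x i hgi)
    have hle : ⟪gg i x, v⟫ + α * g i x ≤ 0 := by
      rw [hvlam]
      refine inner_add_le_zero_of_dual_max (f := f) (h := h) hα0 hpos fun ε _ hεi => ?_
      refine (hd_max x _ _ (fun i' => ?_) fun i' hi' => ?_).trans_eq (hd_eq x)
      · rcases eq_or_ne i' i with rfl | hne
        · simpa using hεi
        · simpa [Pi.single_eq_of_ne hne] using hlam_nn x i'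
      · have hne : i' ≠ i := by
          rintro rfl
          exact hi'.not_ge hgi
        simpa [Pi.single_eq_of_ne hne] using hlam_supp x i' hi'
    rw [le_antisymm hle ((hv_mem x).2 i hgi), mul_zero]
  have hdx : α * dval x = α * f x + ⟪gf x, v⟫ + 1 / 2 * ‖v‖ ^ 2 := by
    have h1 := lagrangian_add_inner (f := f) (g := g) (gf := gf) (gg := gg) (lamh x) (lamg x)
      (hv_mem x).1
    rw [Finset.sum_eq_zero fun i _ => hcompl i, sub_zero] at h1
    have h2 : lagrangianGrad gf gh gg (lamh x) (lamg x) x = -v := by rw [hvlam, neg_neg]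
    have h3 : dval x = lagrangian f h g (lamh x) (lamg x) x - 1 / (2 * α) * ‖v‖ ^ 2 := by
      rw [← norm_neg v, ← h2]
      exact hd_eq x
    rw [h2, inner_neg_left, real_inner_self_eq_norm_sq] at h1
    rw [h3, mul_sub, show α * (1 / (2 * α) * ‖v‖ ^ 2) = 1 / 2 * ‖v‖ ^ 2 by field_simp]
    linarith
  have hgap : f zI - dval x ≤ (Ll - α) / (2 * α ^ 2) * ‖v‖ ^ 2 := by
    obtain ⟨β, γ, hγ0, hγA, hkkt⟩ := exists_multipliers_of_mfcq (gf zI) (fun i => gg i zI)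
      (fun j => gh j zI) (fun i => g i x ≤ 0 ∧ g i zI ≤ 0)
      (by
        obtain ⟨w, hw1, hw2⟩ := (mfcq zI).2
        exact ⟨w, hw1, fun i hi => hw2 i hi.2⟩)
      (by
        intro u hu1 hu2
        by_contra! hneg
        have hdec : ∀ᶠ t : ℝ in nhdsWithin 0 (Set.Ioi 0), f (zI + t • u) < f zI := by
          have hd : HasDerivAt (fun t : ℝ => f (zI + t • u)) ⟪gf zI, u⟫ 0 :=
            HasGradientAt.hasDerivAt_comp_line (by simpa using hf zI)
          filter_upwards [hd.neg.eventually_lt_nhdsGT (neg_pos.2 hneg)] with t ht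
          simpa using ht
        have hfeas : ∀ i, ∀ᶠ t : ℝ in nhdsWithin 0 (Set.Ioi 0),
            g i x ≤ 0 → 0 ≤ g i (zI + t • u) := by
          intro i
          by_cases hix : g i x ≤ 0
          swap
          · exact Eventually.of_forall fun t hi => absurd hi hix
          have hd : HasDerivAt (fun t : ℝ => g i (zI + t • u)) ⟪gg i zI, u⟫ 0 :=
            HasGradientAt.hasDerivAt_comp_line (by simpa using hg i zI)
          by_cases hiz : g i zI ≤ 0
          · filter_upwards [hd.eventually_lt_nhdsGT (hu2 i ⟨hix, hiz⟩)] with t ht _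
            have := hzI.2 i hix
            simp only [zero_smul, add_zero] at ht
            linarith
          · have hpos : 0 < g i (zI + (0 : ℝ) • u) := by simpa using hiz
            filter_upwards [(hd.continuousAt.continuousWithinAt (s := Set.Ioi 0)).eventually
              (lt_mem_nhds hpos)] with t ht _ using ht.le
        obtain ⟨t, ht1, ht2⟩ := (hdec.and (eventually_all.2 hfeas)).exists
        refine ht1.not_ge (hzImin _ ⟨fun j => ?_, ht2⟩)
        rw [hhl j zI, hzI.1 j, add_sub_cancel_left, real_inner_smul_right, hu1 j]
        simp)
    have hγx : ∀ i, 0 < g i x → γ i = 0 := fun i hi => hγA i fun hA => hA.1.not_gt hi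
    have hγz : ∀ i, γ i * g i zI = 0 := by
      intro i
      by_cases hA : g i x ≤ 0 ∧ g i zI ≤ 0
      · rw [le_antisymm hA.2 (hzI.2 i hA.1), mul_zero]
      · rw [hγA i hA, zero_mul]
    have hψz : lagrangian f h g β γ zI = f zI := by
      simp [lagrangian, hzI.1, hγz]
    have hψgrad : lagrangianGrad gf gh gg β γ zI = 0 := by
      rw [lagrangianGrad, sub_eq_zero]
      exact hkkt
    have hmin := lagrangian_strong (β := β) hfl hhl hgl hγ0 zI (x + α⁻¹ • v)
    have hup := le_add_inner_gradient_add_of_lipschitz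
      (hasGradientAt_lagrangian hf hh hg β γ)
      (hLlIx x zI β γ hzI.1 hzI.2 hzImin hγ0 hγx hγz hkkt) x (x + α⁻¹ • v)
    have hdual := lagrangian_add_inner (f := f) (g := g) (gf := gf) (gg := gg) β γ (hv_mem x).1
    have hnn : 0 ≤ ∑ i, γ i * (⟪gg i x, v⟫ + α * g i x) := by
      refine Finset.sum_nonneg fun i _ => ?_
      by_cases hi : g i x ≤ 0
      · exact mul_nonneg (hγ0 i) ((hv_mem x).2 i hi)
      · rw [hγx i (not_le.1 hi), zero_mul]
    rw [hψgrad, hψz, inner_zero_left] at hmin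
    rw [add_sub_cancel_left, real_inner_smul_right, norm_smul, mul_pow, Real.norm_eq_abs,
      sq_abs] at hup
    have h1 : f zI ≤ lagrangian f h g β γ (x + α⁻¹ • v) := by
      have : 0 ≤ μ / 2 * ‖x + α⁻¹ • v - zI‖ ^ 2 := by positivity
      linarith
    have h2 : lagrangian f h g β γ x + α⁻¹ * ⟪lagrangianGrad gf gh gg β γ x, v⟫ ≤
        dval x - α⁻¹ * (1 / 2 * ‖v‖ ^ 2) := by
      refine le_of_mul_le_mul_left ?_ hα0
      rw [mul_add, mul_sub, mul_inv_cancel_left₀ hα0.ne', mul_inv_cancel_left₀ hα0.ne']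
      change α * lagrangian f h g β γ x + ⟪lagrangianGrad gf gh gg β γ x, vfun x⟫ ≤ _
      linarith
    have h3 : (Ll - α) / (2 * α ^ 2) * ‖v‖ ^ 2 =
        Ll / 2 * (α⁻¹ ^ 2 * ‖v‖ ^ 2) - α⁻¹ * (1 / 2 * ‖v‖ ^ 2) := by
      field_simp
    linarith
  have hstep := gradient_step_le hα0 hμLl hT0 hTL
    (lagrangian_strong (β := lamh x) hfl hhl hgl (hlam_nn x))
    (le_add_inner_gradient_add_of_lipschitz
      (hasGradientAt_lagrangian hf hh hg (lamh x) (lamg x)) (hLl x)) x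
  have hnext : x - T • lagrangianGrad gf gh gg (lamh x) (lamg x) x = x + T • v := by
    rw [hvlam, smul_neg, sub_eq_add_neg]
  have hsupp : ∀ i, 0 < g i (x + T • v) → lamg x i = 0 := by
    intro i hi
    by_contra hne
    have hgi : g i x ≤ 0 := by
      by_contra! hgi
      exact hne (hlam_supp x i hgi)
    have h1 : ⟪gg i x, v⟫ = -(α * g i x) :=
      eq_neg_of_add_eq_zero_left ((mul_eq_zero.1 (hcompl i)).resolve_left hne)
    have h2 := hgl i x (x + T • v)
    rw [add_sub_cancel_left, real_inner_smul_right, h1] at h2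
    nlinarith [mul_nonneg (sub_nonneg.2 hμT) (neg_nonneg.2 hgi),
      mul_nonneg (mul_nonneg (sub_nonneg.2 hαμ.le) hT0.le) (neg_nonneg.2 hgi)]
  have hdnext := hd_max (x + T • v) (lamh x) (lamg x) (hlam_nn x) hsupp
  rw [hnext] at hstep
  have hvn : ‖lagrangianGrad gf gh gg (lamh x) (lamg x) x‖ ^ 2 = ‖v‖ ^ 2 := by
    rw [hvlam, norm_neg]
  have hmain : dval x + T * (1 - μ * T / 2) * (μ - α) / α * ‖v‖ ^ 2 ≤ dval (x + T • v) := by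
    rw [← hvn, hd_eq x]
    exact hstep.trans hdnext
  have hcoef : 0 ≤ 2 * α * (1 - μ * T / 2) * (μ - α) / (Ll - α) * T := by
    have := sub_pos.2 hαμ
    positivity
  have hfin := mul_le_mul_of_nonneg_left hgap hcoef
  have heq : 2 * α * (1 - μ * T / 2) * (μ - α) / (Ll - α) * T *
      ((Ll - α) / (2 * α ^ 2) * ‖v‖ ^ 2) = T * (1 - μ * T / 2) * (μ - α) / α * ‖v‖ ^ 2 := by
    field_simp
  linarith
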